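/- Assume 0 < θ ≤ 1/9 and C⋆ ≥ 1/5, and suppose sup over unit q of ‖grad F(q) − grad f(q)‖₂ ≤ δ₁ with δ₁ ≤ 10⁻⁴ and sup over unit q of ‖Hess F(q) − Hess f(q)‖_op ≤ δ₂ with δ₂ ≤ 10⁻³. Let q ∈ ℝ^p be a unit vector with grad F(q) = 0 and ‖Aᵀq‖_∞² ≥ C⋆; write ζ = Aᵀq and b = max over j of |⟨grad f(q) − grad F(q), a_j⟩|. If there exist distinct indices i ≠ j with |ζ_i| ≥ √(α(q)) − 2b/α(q) and |ζ_j| ≥ √(α(q)) − 2b/α(q), then there exists a unit vector v with vᵀq = 0 such that vᵀ Hess F(q) v ≤ −0.00315 < 0. -/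

import Mathlib

open Matrix MeasureTheory ProbabilityTheory Real
open scoped BigOperators ENNReal

noncomputable section

/-- squared Euclidean norm -/
def l2sq {m : ℕ} (v : Fin m → ℝ) : ℝ := ∑ i, v i ^ 2

/-- fourth power of the ℓ₄ norm -/
def l4p4 {m : ℕ} (v : Fin m → ℝ) : ℝ := ∑ i, v i ^ 4

/-- Euclidean norm -/
def l2norm {m : ℕ} (v : Fin m → ℝ) : ℝ := Real.sqrt (l2sq v)

/-- squared sup-norm -/
def linfSq {m : ℕ} (v : Fin m → ℝ) : ℝ := ⨆ i, (v i) ^ 2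

/-- projection onto the orthogonal complement of q -/
def proj {p : ℕ} (q : Fin p → ℝ) : Matrix (Fin p) (Fin p) ℝ := 1 - Matrix.vecMulVec q q

def zeta {p r : ℕ} (A : Matrix (Fin p) (Fin r) ℝ) (q : Fin p → ℝ) : Fin r → ℝ := Aᵀ *ᵥ q

/-- population objective -/
def fpop {p r : ℕ} (θ : ℝ) (A : Matrix (Fin p) (Fin r) ℝ) (q : Fin p → ℝ) : ℝ :=
  -(1/4) * ((1 - θ) * l4p4 (zeta A q) + θ * (l2sq (zeta A q)) ^ 2)

/-- Riemannian gradient of the population objective -/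
def gradf {p r : ℕ} (θ : ℝ) (A : Matrix (Fin p) (Fin r) ℝ) (q : Fin p → ℝ) : Fin p → ℝ :=
  -((proj q) *ᵥ ((1 - θ) • (A *ᵥ fun j => (zeta A q j) ^ 3)
      + (θ * l2sq (zeta A q)) • (A *ᵥ zeta A q)))

/-- Riemannian Hessian of the population objective -/
def hessf {p r : ℕ} (θ : ℝ) (A : Matrix (Fin p) (Fin r) ℝ) (q : Fin p → ℝ) :
    Matrix (Fin p) (Fin p) ℝ :=
  -((1 - θ) • (proj q *
      ((3 : ℝ) • (A * Matrix.diagonal (fun j => (zeta A q j) ^ 2) * Aᵀ)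
        - l4p4 (zeta A q) • (1 : Matrix (Fin p) (Fin p) ℝ)) * proj q))
  - θ • (proj q *
      (l2sq (zeta A q) • (A * Aᵀ)
        + (2 : ℝ) • (A * Aᵀ * Matrix.vecMulVec q q * (A * Aᵀ))
        - (l2sq (zeta A q)) ^ 2 • (1 : Matrix (Fin p) (Fin p) ℝ)) * proj q)

/-- quadratic form -/
def qform {p : ℕ} (M : Matrix (Fin p) (Fin p) ℝ) (v : Fin p → ℝ) : ℝ := v ⬝ᵥ (M *ᵥ v)

/-- α(q) -/
def alphaf {p r : ℕ} (θ : ℝ) (A : Matrix (Fin p) (Fin r) ℝ) (q : Fin p → ℝ) : ℝ :=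
  l4p4 (zeta A q) + (θ / (1 - θ)) * ((l2sq (zeta A q)) ^ 2 - l2sq (zeta A q))

/-- columns of X -/
def colX {r n : ℕ} (X : Matrix (Fin r) (Fin n) ℝ) (k : Fin n) : Fin r → ℝ := fun i => X i k

/-- finite-sample objective -/
def Ffun {p r n : ℕ} (θ σ : ℝ) (A : Matrix (Fin p) (Fin r) ℝ) (X : Matrix (Fin r) (Fin n) ℝ)
    (q : Fin p → ℝ) : ℝ :=
  -(1 / (12 * θ * σ ^ 4 * n)) * ∑ k : Fin n, (q ⬝ᵥ (A *ᵥ colX X k)) ^ 4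

/-- Riemannian gradient of the finite-sample objective -/
def gradF {p r n : ℕ} (θ σ : ℝ) (A : Matrix (Fin p) (Fin r) ℝ) (X : Matrix (Fin r) (Fin n) ℝ)
    (q : Fin p → ℝ) : Fin p → ℝ :=
  (-(1 / (3 * θ * σ ^ 4 * n))) •
    ((proj q) *ᵥ ∑ k : Fin n, ((q ⬝ᵥ (A *ᵥ colX X k)) ^ 3) • (A *ᵥ colX X k))

/-- Riemannian Hessian of the finite-sample objective -/
def hessF {p r n : ℕ} (θ σ : ℝ) (A : Matrix (Fin p) (Fin r) ℝ) (X : Matrix (Fin r) (Fin n) ℝ)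
    (q : Fin p → ℝ) : Matrix (Fin p) (Fin p) ℝ :=
  (-(1 / (3 * θ * σ ^ 4 * n))) •
    ∑ k : Fin n, proj q *
      ((3 * (q ⬝ᵥ (A *ᵥ colX X k)) ^ 2) • Matrix.vecMulVec (A *ᵥ colX X k) (A *ᵥ colX X k)
        - ((q ⬝ᵥ (A *ᵥ colX X k)) ^ 4) • (1 : Matrix (Fin p) (Fin p) ℝ)) * proj q

/-- spectral norm of a rectangular matrix -/
def opNorm {m n : ℕ} (M : Matrix (Fin m) (Fin n) ℝ) : ℝ :=
  ‖LinearMap.toContinuousLinearMap (Matrix.toEuclideanLin M)‖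

/-- Bernoulli(θ) law on ℝ -/
def bernoulliReal (θ : ℝ) : Measure ℝ :=
  ENNReal.ofReal θ • Measure.dirac (1 : ℝ) + ENNReal.ofReal (1 - θ) • Measure.dirac (0 : ℝ)

/-- Bernoulli–Gaussian law BG(θ, σ²) on ℝ -/
def bgLaw (θ σ2 : ℝ) : Measure ℝ :=
  ((bernoulliReal θ).prod (gaussianReal 0 σ2.toNNReal)).map fun p => p.1 * p.2

/-- law of a random vector in ℝ^r with i.i.d. BG(θ, σ²) entries -/
def bgVec (r : ℕ) (θ σ2 : ℝ) : Measure (Fin r → ℝ) :=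
  Measure.pi fun _ : Fin r => bgLaw θ σ2

/-- law of a random r×n matrix with i.i.d. BG(θ, σ²) entries -/
def bgMatrix (r n : ℕ) (θ σ2 : ℝ) : Measure (Fin r → Fin n → ℝ) :=
  Measure.pi fun _ : Fin r => Measure.pi fun _ : Fin n => bgLaw θ σ2


lemma l2sq_eq_dotProduct {m : ℕ} (v : Fin m → ℝ) : l2sq v = v ⬝ᵥ v := by
  simp [l2sq, dotProduct, sq]

lemma qform_smul_vec {p : ℕ} (M : Matrix (Fin p) (Fin p) ℝ) (c : ℝ) (v : Fin p → ℝ) :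
    qform M (c • v) = c ^ 2 * qform M v := by
  simp only [qform, mulVec_smul, smul_dotProduct, dotProduct_smul, smul_eq_mul]
  ring

lemma qform_add {p : ℕ} (M N : Matrix (Fin p) (Fin p) ℝ) (v : Fin p → ℝ) :
    qform (M + N) v = qform M v + qform N v := by
  simp [qform, add_mulVec, dotProduct_add]

lemma qform_sub {p : ℕ} (M N : Matrix (Fin p) (Fin p) ℝ) (v : Fin p → ℝ) :
    qform (M - N) v = qform M v - qform N v := by
  simp [qform, sub_mulVec, dotProduct_sub]

lemma qform_neg {p : ℕ} (M : Matrix (Fin p) (Fin p) ℝ) (v : Fin p → ℝ) :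
    qform (-M) v = -qform M v := by
  simp [qform, neg_mulVec, dotProduct_neg]

lemma qform_smul {p : ℕ} (c : ℝ) (M : Matrix (Fin p) (Fin p) ℝ) (v : Fin p → ℝ) :
    qform (c • M) v = c * qform M v := by
  simp [qform, smul_mulVec, dotProduct_smul]

lemma qform_one {p : ℕ} (v : Fin p → ℝ) :
    qform (1 : Matrix (Fin p) (Fin p) ℝ) v = v ⬝ᵥ v := by
  simp [qform]

lemma proj_mulVec {p : ℕ} (q v : Fin p → ℝ) : proj q *ᵥ v = v - (q ⬝ᵥ v) • q := by
  ext k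
  simp [proj, sub_mulVec, vecMulVec_mulVec, mul_comm]

lemma proj_transpose {p : ℕ} (q : Fin p → ℝ) : (proj q)ᵀ = proj q := by
  simp [proj, transpose_vecMulVec]

/-- Compression to the tangent space does not change the form on tangent vectors. -/
lemma qform_proj_mul_proj {p : ℕ} (M : Matrix (Fin p) (Fin p) ℝ) (q v : Fin p → ℝ)
    (h : q ⬝ᵥ v = 0) : qform (proj q * M * proj q) v = qform M v := by
  have h1 : proj q *ᵥ v = v := by simp [proj_mulVec, h]
  have h2 : v ᵥ* proj q = v := by rw [← mulVec_transpose, proj_transpose, h1]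
  rw [qform, qform, ← mulVec_mulVec, ← mulVec_mulVec, h1, dotProduct_mulVec, h2]

lemma qform_le_opNorm {p : ℕ} (M : Matrix (Fin p) (Fin p) ℝ) (v : Fin p → ℝ) :
    qform M v ≤ opNorm M * l2sq v := by
  have h1 := real_inner_le_norm (WithLp.toLp 2 v)
    (LinearMap.toContinuousLinearMap (Matrix.toEuclideanLin M) (WithLp.toLp 2 v))
  have h2 := (LinearMap.toContinuousLinearMap (Matrix.toEuclideanLin M)).le_opNorm
    (WithLp.toLp 2 v)
  have h3 : inner ℝ (WithLp.toLp 2 v)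
      (LinearMap.toContinuousLinearMap (Matrix.toEuclideanLin M) (WithLp.toLp 2 v))
      = qform M v := by
    simp [EuclideanSpace.inner_eq_star_dotProduct, qform, dotProduct_comm]
  have h4 : ‖WithLp.toLp 2 v‖ ^ 2 = l2sq v := by
    simp [EuclideanSpace.norm_sq_eq, l2sq]
  rw [h3] at h1
  rw [opNorm, ← h4]
  nlinarith [norm_nonneg (WithLp.toLp 2 v)]

/-- A nonzero tangent vector along which the form is negative can be normalized. -/
lemma exists_unit_qform_le {p : ℕ} (M : Matrix (Fin p) (Fin p) ℝ) (q u : Fin p → ℝ) (c : ℝ)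
    (hu : 0 < l2sq u) (huq : u ⬝ᵥ q = 0) (h : qform M u ≤ c * l2sq u) :
    ∃ v : Fin p → ℝ, l2sq v = 1 ∧ v ⬝ᵥ q = 0 ∧ qform M v ≤ c := by
  have hs : ((√(l2sq u))⁻¹) ^ 2 = (l2sq u)⁻¹ := by rw [inv_pow, Real.sq_sqrt hu.le]
  refine ⟨(√(l2sq u))⁻¹ • u, ?_, by simp [huq], ?_⟩
  · have : l2sq ((√(l2sq u))⁻¹ • u) = ((√(l2sq u))⁻¹) ^ 2 * l2sq u := by
      simp [l2sq, mul_pow, Finset.mul_sum]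
    rw [this, hs, inv_mul_cancel₀ hu.ne']
  · rw [qform_smul_vec, hs, inv_mul_le_iff₀ hu]
    linarith

lemma transpose_mulVec_mulVec {p r : ℕ} {A : Matrix (Fin p) (Fin r) ℝ} (hA : Aᵀ * A = 1)
    (w : Fin r → ℝ) : Aᵀ *ᵥ (A *ᵥ w) = w := by
  rw [mulVec_mulVec, hA, one_mulVec]

lemma mulVec_dotProduct_eq_zeta {p r : ℕ} (A : Matrix (Fin p) (Fin r) ℝ) (w : Fin r → ℝ)
    (q : Fin p → ℝ) : (A *ᵥ w) ⬝ᵥ q = w ⬝ᵥ zeta A q := by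
  rw [zeta, dotProduct_mulVec, vecMul_transpose]

lemma gradf_dotProduct_col {p r : ℕ} {A : Matrix (Fin p) (Fin r) ℝ} (hA : Aᵀ * A = 1)
    {θ : ℝ} (hθ : θ < 1) (q : Fin p → ℝ) (k : Fin r) :
    gradf θ A q ⬝ᵥ (fun l => A l k)
      = -(1 - θ) * (zeta A q k ^ 3 - alphaf θ A q * zeta A q k) := by
  have hcol : ∀ v : Fin p → ℝ, v ⬝ᵥ (fun l => A l k) = (Aᵀ *ᵥ v) k := fun v => by
    rw [dotProduct_comm]; rfl
  have h1 : 1 - θ ≠ 0 := by linarith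
  have h3 : (fun j => zeta A q j ^ 3) ⬝ᵥ zeta A q = l4p4 (zeta A q) := by
    simp only [dotProduct, l4p4]
    exact Finset.sum_congr rfl fun _ _ => by ring
  rw [hcol, gradf, proj_mulVec, mulVec_neg, mulVec_sub, mulVec_add, mulVec_smul, mulVec_smul,
    mulVec_smul, transpose_mulVec_mulVec hA, transpose_mulVec_mulVec hA, dotProduct_add,
    dotProduct_smul, dotProduct_smul, dotProduct_comm q, dotProduct_comm q,
    mulVec_dotProduct_eq_zeta, mulVec_dotProduct_eq_zeta, h3, ← l2sq_eq_dotProduct]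
  change -((((1 - θ) * zeta A q k ^ 3 + θ * l2sq (zeta A q) * zeta A q k)
    - ((1 - θ) * l4p4 (zeta A q) + θ * l2sq (zeta A q) * l2sq (zeta A q)) * zeta A q k)) = _
  rw [alphaf]
  field_simp
  ring

/-- The population Hessian on tangent vectors in the range of `A`. -/
lemma qform_hessf_mulVec {p r : ℕ} {A : Matrix (Fin p) (Fin r) ℝ} (hA : Aᵀ * A = 1)
    {θ : ℝ} (hθ : θ < 1) (q : Fin p → ℝ) (w : Fin r → ℝ) (hw : w ⬝ᵥ zeta A q = 0) :
    qform (hessf θ A q) (A *ᵥ w)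
      = -(1 - θ) * (3 * ∑ k, zeta A q k ^ 2 * w k ^ 2 - alphaf θ A q * l2sq w) := by
  have hq : q ⬝ᵥ (A *ᵥ w) = 0 := by rw [dotProduct_comm, mulVec_dotProduct_eq_zeta, hw]
  have h1 : 1 - θ ≠ 0 := by linarith
  have hD : qform (A * diagonal (fun j => zeta A q j ^ 2) * Aᵀ) (A *ᵥ w)
      = ∑ k, zeta A q k ^ 2 * w k ^ 2 := by
    rw [qform, ← mulVec_mulVec, transpose_mulVec_mulVec hA, ← mulVec_mulVec, dotProduct_mulVec,
      ← mulVec_transpose, transpose_mulVec_mulVec hA]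
    simp only [dotProduct, mulVec_diagonal]
    exact Finset.sum_congr rfl fun _ _ => by ring
  have hI : (A *ᵥ w) ⬝ᵥ (A *ᵥ w) = l2sq w := by
    rw [mulVec_dotProduct_eq_zeta, zeta, transpose_mulVec_mulVec hA, l2sq_eq_dotProduct]
  have hAA : (A * Aᵀ) *ᵥ (A *ᵥ w) = A *ᵥ w := by
    rw [← mulVec_mulVec, transpose_mulVec_mulVec hA]
  have hP : qform (A * Aᵀ) (A *ᵥ w) = l2sq w := by rw [qform, hAA, hI]
  have hR : qform (A * Aᵀ * vecMulVec q q * (A * Aᵀ)) (A *ᵥ w) = 0 := by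
    rw [qform, ← mulVec_mulVec, hAA, ← mulVec_mulVec, vecMulVec_mulVec, hq]
    simp
  rw [hessf, qform_sub, qform_neg, qform_smul, qform_smul, qform_proj_mul_proj _ _ _ hq,
    qform_proj_mul_proj _ _ _ hq, qform_sub, qform_sub, qform_add, qform_smul, qform_smul,
    qform_smul, qform_smul, qform_smul, qform_one, hD, hI, hP, hR, alphaf]
  field_simp
  ring

lemma abs_dotProduct_col_le {p r : ℕ} {A : Matrix (Fin p) (Fin r) ℝ} (hA : Aᵀ * A = 1)
    (g : Fin p → ℝ) (k : Fin r) : |g ⬝ᵥ (fun l => A l k)| ≤ l2norm g := by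
  have hk : ∑ l, A l k ^ 2 = 1 := by
    have := congrFun (congrFun hA k) k
    simpa [mul_apply, sq] using this
  rw [l2norm]
  apply Real.abs_le_sqrt
  have := Finset.sum_mul_sq_le_sq_mul_sq Finset.univ g (fun l => A l k)
  rw [hk, mul_one] at this
  exact this

/-- An approximate root `z` of `z ^ 3 = α z` with `z ^ 2 ≥ 1 / 5` forces `α` to be close to
`z ^ 2`. -/
lemma le_of_cubic_approx {z α : ℝ} (hz : 1 / 5 ≤ z ^ 2)
    (h : |z ^ 3 - α * z| ≤ 1 / 5000) : 19 / 100 ≤ α := by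
  have h1 : z ^ 3 - α * z = (z ^ 2 - α) * z := by ring
  rw [h1, abs_mul] at h
  have h2 : (2 / 5 : ℝ) ≤ |z| := by
    apply abs_le_of_sq_le_sq' _ (abs_nonneg z) |>.2
    rw [sq_abs]
    linarith
  have h3 := le_abs_self (z ^ 2 - α)
  nlinarith [abs_nonneg (z ^ 2 - α)]

lemma sq_ge_of_sqrt_sub_le {z α b : ℝ} (hα : 19 / 100 ≤ α) (hb : b ≤ 1 / 10 ^ 4)
    (h : √α - 2 * b / α ≤ |z|) : 4 / 5 * α ≤ z ^ 2 := by
  have h1 : 2 * b / α ≤ 1 / 500 := by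
    rw [div_le_iff₀ (by linarith)]
    linarith
  have h2 : (2 / 5 : ℝ) ≤ √α := Real.le_sqrt_of_sq_le (by linarith)
  have h3 : √α ^ 2 = α := Real.sq_sqrt (by linarith)
  rw [← sq_abs]
  nlinarith

theorem stmt13 (p r n : ℕ) (hr : 1 ≤ r) (hrp : r ≤ p) (hn : 1 ≤ n)
    (A : Matrix (Fin p) (Fin r) ℝ) (hA : Aᵀ * A = 1)
    (X : Matrix (Fin r) (Fin n) ℝ)
    (θ σ Cstar δ1 δ2 b : ℝ) (hθ0 : 0 < θ) (hθ : θ ≤ 1/9) (hσ : 0 < σ)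
    (hC : 1/5 ≤ Cstar) (hδ1b : δ1 ≤ 1/10^4) (hδ2b : δ2 ≤ 1/10^3)
    (hδ1 : ∀ q : Fin p → ℝ, l2sq q = 1 → l2norm (gradF θ σ A X q - gradf θ A q) ≤ δ1)
    (hδ2 : ∀ q : Fin p → ℝ, l2sq q = 1 → opNorm (hessF θ σ A X q - hessf θ A q) ≤ δ2)
    (q : Fin p → ℝ) (hq : l2sq q = 1) (hgrad : gradF θ σ A X q = 0)
    (hinf : Cstar ≤ linfSq (zeta A q))
    (hb : b = ⨆ j : Fin r, |(gradf θ A q - gradF θ σ A X q) ⬝ᵥ (fun k => A k j)|)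
    (i j : Fin r) (hij : i ≠ j)
    (hi : Real.sqrt (alphaf θ A q) - 2*b/(alphaf θ A q) ≤ |zeta A q i|)
    (hj : Real.sqrt (alphaf θ A q) - 2*b/(alphaf θ A q) ≤ |zeta A q j|) :
    ∃ v : Fin p → ℝ, l2sq v = 1 ∧ v ⬝ᵥ q = 0 ∧
      qform (hessF θ σ A X q) v ≤ -(0.00315 : ℝ) := by
  have hθ1 : θ < 1 := by linarith
  have : Nonempty (Fin r) := ⟨i⟩
  set ζ := zeta A q with hζ
  set α := alphaf θ A q with hα
  have hg : ∀ k : Fin r, |gradf θ A q ⬝ᵥ (fun l => A l k)| ≤ 1 / 10 ^ 4 := fun k => by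
    have h1 := hδ1 q hq
    have h2 := abs_dotProduct_col_le hA (gradF θ σ A X q - gradf θ A q) k
    rw [hgrad, zero_sub, neg_dotProduct, abs_neg] at h2
    rw [hgrad, zero_sub] at h1
    linarith
  have hb' : b ≤ 1 / 10 ^ 4 := by
    rw [hb, hgrad, sub_zero]
    exact ciSup_le hg
  have hcubic : ∀ k : Fin r, |ζ k ^ 3 - α * ζ k| ≤ 1 / 5000 := fun k => by
    have h1 := hg k
    rw [gradf_dotProduct_col hA hθ1, abs_mul, abs_neg, abs_of_pos (by linarith : 0 < 1 - θ)] at h1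
    nlinarith [abs_nonneg (ζ k ^ 3 - α * ζ k)]
  obtain ⟨m, hm⟩ := exists_eq_ciSup_of_finite (f := fun k => ζ k ^ 2)
  have hα0 : 19 / 100 ≤ α := by
    refine le_of_cubic_approx (z := ζ m) ?_ (hcubic m)
    rw [linfSq, ← hm] at hinf
    linarith
  have hx := sq_ge_of_sqrt_sub_le hα0 hb' hi
  have hy := sq_ge_of_sqrt_sub_le hα0 hb' hj
  set w : Fin r → ℝ := Pi.single i (ζ j) - Pi.single j (ζ i) with hw
  have hwζ : w ⬝ᵥ ζ = 0 := by
    simp only [hw, sub_dotProduct, single_dotProduct]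
    ring
  have hsum : ∀ c : Fin r → ℝ, ∑ k, c k * w k ^ 2 = c i * ζ j ^ 2 + c j * ζ i ^ 2 := fun c => by
    have hk : ∀ k, c k * w k ^ 2
        = (if k = i then c i * ζ j ^ 2 else 0) + (if k = j then c j * ζ i ^ 2 else 0) := by
      intro k
      by_cases h1 : k = i
      · subst h1
        simp [hw, hij]
      · by_cases h2 : k = j
        · subst h2
          simp [hw, h1]
        · simp [hw, h1, h2]
    simp [hk, Finset.sum_add_distrib]
  have hW : l2sq w = ζ j ^ 2 + ζ i ^ 2 := by simpa [l2sq] using hsum 1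
  have hU : l2sq (A *ᵥ w) = l2sq w := by
    rw [l2sq_eq_dotProduct, mulVec_dotProduct_eq_zeta, zeta, transpose_mulVec_mulVec hA,
      l2sq_eq_dotProduct]
  have hf := qform_hessf_mulVec hA hθ1 q w hwζ
  rw [← hζ, ← hα, hsum (fun k => ζ k ^ 2), hW] at hf
  have hd := qform_le_opNorm (hessF θ σ A X q - hessf θ A q) (A *ᵥ w)
  rw [qform_sub, hU, hW] at hd
  have hop := (hδ2 q hq).trans hδ2b
  refine exists_unit_qform_le _ q (A *ᵥ w) _ ?_ ?_ ?_
  · rw [hU, hW]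
    linarith
  · rw [mulVec_dotProduct_eq_zeta, ← hζ, hwζ]
  · rw [hU, hW]
    generalize ζ i ^ 2 = x at *
    generalize ζ j ^ 2 = y at *
    have hS : 0 < y + x := by linarith
    have h1 := mul_le_mul_of_nonneg_right hop hS.le
    have h2 : 4 / 5 * α * (y + x) ≤ x * y + y * x := by nlinarith
    have h3 : 19 / 100 * (y + x) ≤ 3 * (x * y + y * x) - α * (y + x) := by nlinarith
    have h4 : 1 / 10 * (y + x) ≤ (1 - θ) * (3 * (x * y + y * x) - α * (y + x)) := by nlinarith
    linarith

end
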